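/- Let a, b > 0 and N ∈ ℕ. If 0 ≤ ν ≤ 1/2, then (ν a + (1−ν) b)² + S_N(2ν; ab, a²) ≤ (a^ν b^{1−ν})² + (1−ν)²(a−b)². If 1/2 ≤ ν ≤ 1, then (ν a + (1−ν) b)² + S_N(2−2ν; ab, b²) ≤ (a^ν b^{1−ν})² + ν²(a−b)². -/

import Mathlib

open Real Finset

noncomputable def kj (j : ℕ) (ν : ℝ) : ℤ := ⌊(2:ℝ)^(j-1) * ν⌋

noncomputable def rj (j : ℕ) (ν : ℝ) : ℤ := ⌊(2:ℝ)^j * ν⌋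

noncomputable def sj (j : ℕ) (ν : ℝ) : ℝ :=
  (-1:ℝ)^(rj j ν) * (2:ℝ)^(j-1) * ν
    + (-1:ℝ)^(rj j ν + 1) * (⌊((rj j ν : ℝ) + 1)/2⌋ : ℤ)

noncomputable def SS (N : ℕ) (ν a b : ℝ) : ℝ :=
  ∑ j ∈ Finset.Icc 1 N, sj j ν *
    ((b ^ ((2:ℝ)^(j-1) - (kj j ν : ℝ)) * a ^ ((kj j ν : ℝ))) ^ ((1:ℝ)/2^j)
      - (a ^ ((kj j ν : ℝ) + 1) * b ^ ((2:ℝ)^(j-1) - (kj j ν : ℝ) - 1)) ^ ((1:ℝ)/2^j))^2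

/-- The weighted geometric mean of `exp α` and `exp β`, as a function of the weight. -/
noncomputable def expMean (α β t : ℝ) : ℝ := Real.exp (t * α + (1 - t) * β)

/-- The piecewise linear interpolation of `expMean α β` on the grid of mesh `2⁻ʲ`. -/
noncomputable def dyadicInterp (α β ν : ℝ) (j : ℕ) : ℝ :=
  (1 - Int.fract (2 ^ j * ν)) * expMean α β (⌊(2:ℝ) ^ j * ν⌋ / 2 ^ j)
    + Int.fract (2 ^ j * ν) * expMean α β ((⌊(2:ℝ) ^ j * ν⌋ + 1) / 2 ^ j)

lemma expMean_le_dyadicInterp (α β ν : ℝ) (j : ℕ) :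
    expMean α β ν ≤ dyadicInterp α β ν j := by
  have h := convexOn_exp.2 (Set.mem_univ (⌊(2:ℝ) ^ j * ν⌋ / 2 ^ j * α
      + (1 - ⌊(2:ℝ) ^ j * ν⌋ / 2 ^ j) * β))
    (Set.mem_univ ((⌊(2:ℝ) ^ j * ν⌋ + 1) / 2 ^ j * α
      + (1 - (⌊(2:ℝ) ^ j * ν⌋ + 1) / 2 ^ j) * β))
    (sub_nonneg.2 (Int.fract_lt_one ((2:ℝ) ^ j * ν)).le)
    (Int.fract_nonneg ((2:ℝ) ^ j * ν)) (by ring)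
  simp only [smul_eq_mul] at h
  unfold dyadicInterp expMean
  refine le_of_eq_of_le ?_ h
  congr 1
  have hp : (2:ℝ) ^ j ≠ 0 := by positivity
  unfold Int.fract
  field_simp
  ring

lemma dyadicInterp_zero {ν : ℝ} (α β : ℝ) (h0 : 0 ≤ ν) (h1 : ν ≤ 1) :
    dyadicInterp α β ν 0 = ν * Real.exp α + (1 - ν) * Real.exp β := by
  rcases h1.eq_or_lt with rfl | h1
  · simp [dyadicInterp, expMean]
  · have hf : ⌊ν⌋ = 0 := Int.floor_eq_zero_iff.2 ⟨h0, h1⟩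
    simp [dyadicInterp, expMean, Int.fract, hf]
    ring

lemma floor_two_mul_eq_or (x : ℝ) :
    ⌊2 * x⌋ = 2 * ⌊x⌋ ∨ ⌊2 * x⌋ = 2 * ⌊x⌋ + 1 := by
  have h1 : 2 * ⌊x⌋ ≤ ⌊2 * x⌋ := by
    rw [Int.le_floor]; push_cast; linarith [Int.floor_le x]
  have h2 : ⌊2 * x⌋ < 2 * ⌊x⌋ + 2 := by
    rw [Int.floor_lt]; push_cast; linarith [Int.lt_floor_add_one x]
  omega

lemma exp_rpow_mul_exp_rpow_rpow (α β m n p : ℝ) :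
    (Real.exp α ^ m * Real.exp β ^ n) ^ p = Real.exp ((m * α + n * β) * p) := by
  rw [← Real.exp_mul, ← Real.exp_mul, ← Real.exp_add, ← Real.exp_mul]
  ring_nf

lemma dyadicInterp_eq_succ_add (α β ν : ℝ) (j : ℕ) :
    dyadicInterp α β ν j = dyadicInterp α β ν (j + 1) + sj (j + 1) ν *
      ((Real.exp β ^ ((2:ℝ) ^ j - (kj (j + 1) ν : ℝ)) * Real.exp α ^ ((kj (j + 1) ν : ℝ)))
          ^ ((1:ℝ) / 2 ^ (j + 1))
        - (Real.exp α ^ ((kj (j + 1) ν : ℝ) + 1)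
          * Real.exp β ^ ((2:ℝ) ^ j - (kj (j + 1) ν : ℝ) - 1)) ^ ((1:ℝ) / 2 ^ (j + 1))) ^ 2 := by
  have hp : (2:ℝ) ^ j ≠ 0 := by positivity
  have hk : kj (j + 1) ν = ⌊(2:ℝ) ^ j * ν⌋ := by simp [kj]
  have hr : (2:ℝ) ^ (j + 1) * ν = 2 * (2 ^ j * ν) := by ring
  rw [hk, exp_rpow_mul_exp_rpow_rpow, exp_rpow_mul_exp_rpow_rpow]
  simp only [dyadicInterp, sj, rj, add_tsub_cancel_right, hr, Int.fract]
  have hx := floor_two_mul_eq_or ((2:ℝ) ^ j * ν)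
  set k := ⌊(2:ℝ) ^ j * ν⌋
  set u := Real.exp ((((2:ℝ) ^ j - k) * β + k * α) * (1 / 2 ^ (j + 1))) with hu
  set v := Real.exp (((k + 1) * α + ((2:ℝ) ^ j - k - 1) * β) * (1 / 2 ^ (j + 1))) with hv
  have huu : expMean α β (k / 2 ^ j) = u * u := by
    rw [hu, ← Real.exp_add, expMean]; congr 1; field_simp; ring
  have hvv : expMean α β ((k + 1) / 2 ^ j) = v * v := by
    rw [hv, ← Real.exp_add, expMean]; congr 1; field_simp; ring
  have huv : expMean α β ((2 * k + 1) / 2 ^ (j + 1)) = u * v := by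
    rw [hu, hv, ← Real.exp_add, expMean]; congr 1; field_simp; ring
  rcases hx with hx | hx
  · have e1 : (2 * (k:ℝ)) / 2 ^ (j + 1) = k / 2 ^ j := by field_simp; ring
    have e2 : ⌊(2 * (k:ℝ) + 1) / 2⌋ = k := by
      rw [Int.floor_eq_iff]; constructor <;> linarith
    have e3 : (-1:ℝ) ^ (2 * k) = 1 := Even.neg_one_zpow (even_two_mul k)
    have e4 : (-1:ℝ) ^ (2 * k + 1) = -1 := Odd.neg_one_zpow ⟨k, rfl⟩
    rw [hx]
    push_cast
    rw [e1, e2, e3, e4, huu, hvv, huv]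
    ring
  · have e1 : (2 * (k:ℝ) + 1 + 1) / 2 ^ (j + 1) = (k + 1) / 2 ^ j := by field_simp; ring
    have e2 : ⌊(2 * (k:ℝ) + 1 + 1) / 2⌋ = k + 1 := by
      rw [Int.floor_eq_iff]; push_cast; constructor <;> linarith
    have e3 : (-1:ℝ) ^ (2 * k + 1) = -1 := Odd.neg_one_zpow ⟨k, rfl⟩
    have e4 : (-1:ℝ) ^ (2 * k + 1 + 1) = 1 := Even.neg_one_zpow ⟨k + 1, by ring⟩
    rw [hx]
    push_cast
    rw [e1, e2, e3, e4, huu, hvv, huv]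
    push_cast
    ring

lemma dyadicInterp_add_SS (α β ν : ℝ) (N : ℕ) :
    dyadicInterp α β ν N + SS N ν (Real.exp α) (Real.exp β) = dyadicInterp α β ν 0 := by
  induction N with
  | zero => simp [SS]
  | succ n ih =>
    rw [← ih, dyadicInterp_eq_succ_add α β ν n, SS, SS, Finset.sum_Icc_succ_top (by omega)]
    simp only [add_tsub_cancel_right]
    ring

/-- The multiple-term refinement of Young's inequality. -/
lemma rpow_mul_rpow_add_SS_le {a b ν : ℝ} (ha : 0 < a) (hb : 0 < b) (h0 : 0 ≤ ν) (h1 : ν ≤ 1)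
    (N : ℕ) : a ^ ν * b ^ (1 - ν) + SS N ν a b ≤ ν * a + (1 - ν) * b := by
  have h := dyadicInterp_add_SS (Real.log a) (Real.log b) ν N
  have hm := expMean_le_dyadicInterp (Real.log a) (Real.log b) ν N
  rw [dyadicInterp_zero _ _ h0 h1, Real.exp_log ha, Real.exp_log hb] at h
  have hg : expMean (Real.log a) (Real.log b) ν = a ^ ν * b ^ (1 - ν) := by
    rw [Real.rpow_def_of_pos ha, Real.rpow_def_of_pos hb, ← Real.exp_add, expMean]
    ring_nf
  linarith

lemma sq_add_SS_le {a b ν : ℝ} (ha : 0 < a) (hb : 0 < b) (h0 : 0 ≤ ν) (h1 : ν ≤ 1 / 2) (N : ℕ) :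
    (ν * a + (1 - ν) * b) ^ 2 + SS N (2 * ν) (a * b) (a ^ 2)
      ≤ (a ^ ν * b ^ (1 - ν)) ^ 2 + (1 - ν) ^ 2 * (a - b) ^ 2 := by
  have h := rpow_mul_rpow_add_SS_le (mul_pos ha hb) (pow_pos ha 2)
    (show 0 ≤ 2 * ν by linarith) (show 2 * ν ≤ 1 by linarith) N
  have e1 : (a * b) ^ (2 * ν) * (a ^ 2) ^ (1 - 2 * ν) = (a ^ (1 - ν) * b ^ ν) ^ 2 := by
    simp only [Real.rpow_def_of_pos ha, Real.rpow_def_of_pos hb,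
      Real.rpow_def_of_pos (mul_pos ha hb), Real.rpow_def_of_pos (pow_pos ha 2),
      Real.log_mul ha.ne' hb.ne', Real.log_pow, ← Real.exp_add, ← Real.exp_nat_mul]
    push_cast
    ring_nf
  have e2 : (a ^ ν * b ^ (1 - ν)) * (a ^ (1 - ν) * b ^ ν) = a * b := by
    rw [mul_mul_mul_comm, ← Real.rpow_add ha, ← Real.rpow_add hb]
    simp
  rw [e1] at h
  nlinarith [sq_nonneg (a ^ ν * b ^ (1 - ν) - a ^ (1 - ν) * b ^ ν)]

theorem stmt7 (a b ν : ℝ) (ha : 0 < a) (hb : 0 < b) (N : ℕ) :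
    (0 ≤ ν → ν ≤ 1/2 →
      (ν * a + (1 - ν) * b)^2 + SS N (2 * ν) (a * b) (a^2)
        ≤ (a ^ ν * b ^ (1 - ν))^2 + (1 - ν)^2 * (a - b)^2) ∧
    (1/2 ≤ ν → ν ≤ 1 →
      (ν * a + (1 - ν) * b)^2 + SS N (2 - 2 * ν) (a * b) (b^2)
        ≤ (a ^ ν * b ^ (1 - ν))^2 + ν^2 * (a - b)^2) := by
  refine ⟨fun h0 h1 => sq_add_SS_le ha hb h0 h1 N, fun h0 h1 => ?_⟩
  have h := sq_add_SS_le (ν := 1 - ν) hb ha (by linarith) (by linarith) N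
  rw [sub_sub_cancel, mul_comm b a, mul_comm (b ^ _), show 2 * (1 - ν) = 2 - 2 * ν by ring] at h
  linarith
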